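/- arXiv:1805.00194 — 5 statements merged into one kernel-verified Lean document; each statement's English description precedes it below -/
import Mathlib

section
/- Let (λ_n)_{n≥1} be a summable sequence of nonnegative real numbers (the ordered eigenvalues of the covariance operator of a random field), and let ε ∈ (0,1). If N is a natural number such that the tail sum satisfies Σ_{m=N+1}^∞ λ_m ≤ ε² · Σ_{m=1}^∞ λ_m, then (1−ε²)² · (Σ_{m=1}^∞ λ_m)² ≤ N · Σ_{m=1}^∞ λ_m². In particular, the minimal such N, denoted N̲^ε, satisfies N̲^ε ≥ (1−ε²)² (Σλ_m)² / (Σλ_m²). -/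
/-- If `(λ_n)_{n≥1}` is a summable sequence of nonnegative reals, `ε ∈ (0,1)`, and the tail
`Σ_{m=N+1}^∞ λ_m ≤ ε² Σ_{m=1}^∞ λ_m`, then `(1−ε²)² (Σ λ_m)² ≤ N · Σ λ_m²`.
Here `lam n` denotes `λ_{n+1}`, so the tail past index `N` is `∑' m, lam (N + m)`. -/
theorem stmt0 (lam : ℕ → ℝ) (hnn : ∀ n, 0 ≤ lam n) (hsum : Summable lam)
    (ε : ℝ) (hε : ε ∈ Set.Ioo (0 : ℝ) 1)
    (N : ℕ) (htail : (∑' m : ℕ, lam (N + m)) ≤ ε ^ 2 * ∑' m, lam m) :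
    (1 - ε ^ 2) ^ 2 * (∑' m, lam m) ^ 2 ≤ (N : ℝ) * ∑' m, lam m ^ 2 := by
  have hsq : Summable fun m => lam m ^ 2 := by
    refine Summable.of_nonneg_of_le (fun m => sq_nonneg _) (fun m => ?_)
      (hsum.mul_left (∑' m, lam m))
    rw [sq]
    exact mul_le_mul_of_nonneg_right (hsum.le_tsum m fun j _ => hnn j) (hnn m)
  have hsplit := hsum.sum_add_tsum_nat_add N
  simp only [add_comm _ N] at hsplit
  have hhead : (1 - ε ^ 2) * ∑' m, lam m ≤ ∑ m ∈ Finset.range N, lam m := by linarith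
  have hε2 : 0 ≤ 1 - ε ^ 2 := by nlinarith [hε.1, hε.2]
  calc (1 - ε ^ 2) ^ 2 * (∑' m, lam m) ^ 2
      = ((1 - ε ^ 2) * ∑' m, lam m) ^ 2 := by ring
    _ ≤ (∑ m ∈ Finset.range N, lam m) ^ 2 :=
        pow_le_pow_left₀ (mul_nonneg hε2 (tsum_nonneg hnn)) hhead 2
    _ ≤ (N : ℝ) * ∑ m ∈ Finset.range N, lam m ^ 2 := by
        simpa using sq_sum_le_card_mul_sum_sq (s := Finset.range N) (f := lam)
    _ ≤ (N : ℝ) * ∑' m, lam m ^ 2 :=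
        mul_le_mul_of_nonneg_left (hsq.sum_le_tsum _ fun m _ => sq_nonneg _) N.cast_nonneg
end

section
/- Let D ⊂ ℝ^d be compact with vol(D) > 0, let f : ℝ^d → ℝ be measurable with f(0) > 0 and ∫_{ℝ^d} f(z)² dz = I ∈ (0,∞), and let σ > 0. Let (λ_n)_{n≥1} be a summable sequence of nonnegative reals satisfying Σ_{n=1}^∞ λ_n = f(0)·vol(D) and Σ_{n=1}^∞ λ_n² = ∬_{D×D} f((x−y)/σ)² dx dy (the eigenvalues of the covariance operator with stationary kernel C_a(x,y) = f((x−y)/σ)). Then for every ε ∈ (0,1), any natural number N with Σ_{m=N+1}^∞ λ_m ≤ ε² Σ_{m=1}^∞ λ_m satisfies N · I · vol(D+D) · σ^d ≥ (1−ε²)² · 2^d · f(0)² · vol(D)². In particular N̲^ε ≥ c(D,f,ε) σ^{−d} with c(D,f,ε) = (1−ε²)² 2^d f(0)² vol(D)² / (I · vol(D+D)). -/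
open MeasureTheory
open scoped Pointwise

/-- The doubling inequality `2 ^ d * vol(D) ≤ vol(D + D)`. -/
theorem two_pow_mul_volume_le_volume_add_self {d : ℕ} {D : Set (Fin d → ℝ)} (hD : IsCompact D) :
    2 ^ d * (volume D).toReal ≤ (volume (D + D)).toReal := by
  have hsub : (2 : ℝ) • D ⊆ D + D := by
    rintro _ ⟨x, hx, rfl⟩
    exact ⟨x, hx, x, hx, (two_smul ℝ x).symm⟩
  have hle := ENNReal.toReal_mono (hD.add hD).measure_ne_top (measure_mono (μ := volume) hsub)
  rw [Measure.addHaar_smul, ENNReal.toReal_mul, Module.finrank_fin_fun,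
    abs_of_nonneg (by positivity), ENNReal.toReal_ofReal (by positivity)] at hle
  exact hle

/-- The integral of a nonnegative stationary kernel `g ((x - y) / σ)` over `D × D` is at most
`σ ^ d * (∫ g) * vol(D)`. -/
theorem setIntegral_setIntegral_stationary_le {d : ℕ} {D : Set (Fin d → ℝ)}
    (hD : volume D < ⊤) {g : (Fin d → ℝ) → ℝ} (hg : ∀ z, 0 ≤ g z) (hint : Integrable g)
    {σ : ℝ} (hσ : 0 < σ) :
    ∫ x in D, ∫ y in D, g (σ⁻¹ • (x - y)) ≤ σ ^ d * (∫ z, g z) * (volume D).toReal := by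
  have hscaled : Integrable (fun z => g (σ⁻¹ • z)) := hint.comp_smul (inv_ne_zero hσ.ne')
  have hinner (x : Fin d → ℝ) : ∫ y in D, g (σ⁻¹ • (x - y)) ≤ σ ^ d * ∫ z, g z := by
    calc ∫ y in D, g (σ⁻¹ • (x - y)) ≤ ∫ y, g (σ⁻¹ • (x - y)) :=
          setIntegral_le_integral (hscaled.comp_sub_left x) (.of_forall fun _ => hg _)
      _ = ∫ z, g (σ⁻¹ • z) := integral_sub_left_eq_self (fun z => g (σ⁻¹ • z)) volume x
      _ = σ ^ d * ∫ z, g z := by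
          rw [Measure.integral_comp_inv_smul, Module.finrank_fin_fun,
            abs_of_nonneg (by positivity), smul_eq_mul]
  refine (Real.le_norm_self _).trans (norm_setIntegral_le_of_norm_le_const hD fun x _ => ?_)
  rw [Real.norm_of_nonneg (integral_nonneg fun _ => hg _)]
  exact hinner x

/-- For a summable nonnegative sequence, the square of a partial sum with `N` terms is at most
`N` times the sum of all squares. -/
theorem sq_sum_range_le_mul_tsum_sq {u : ℕ → ℝ} (hnn : ∀ n, 0 ≤ u n) (hsum : Summable u)
    (N : ℕ) : (∑ n ∈ Finset.range N, u n) ^ 2 ≤ N * ∑' n, u n ^ 2 := by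
  have hsq : Summable (fun n => u n ^ 2) := by
    refine hsum.of_norm_bounded_eventually_nat ?_
    filter_upwards [hsum.tendsto_atTop_zero.eventually_le_const one_pos] with n hn
    rw [Real.norm_of_nonneg (sq_nonneg _)]
    nlinarith [hnn n]
  calc (∑ n ∈ Finset.range N, u n) ^ 2 ≤ N * ∑ n ∈ Finset.range N, u n ^ 2 := by
        simpa using sq_sum_le_card_mul_sum_sq (s := Finset.range N) (f := u)
    _ ≤ N * ∑' n, u n ^ 2 := by
        gcongr
        exact hsq.sum_le_tsum _ fun n _ => sq_nonneg _

/-- Scaling law lower bound: with `Σ λ_n = f(0) vol(D)` and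
`Σ λ_n² = ∬_{D×D} f((x−y)/σ)² dx dy`, any `N` with tail `≤ ε²` of the total variance satisfies
`N · I · vol(D+D) · σ^d ≥ (1−ε²)² 2^d f(0)² vol(D)²`. Here `lam n` denotes `λ_{n+1}`. -/
theorem stmt3 (d : ℕ) (D : Set (Fin d → ℝ)) (hD : IsCompact D)
    (hDvol : 0 < (volume D).toReal)
    (f : (Fin d → ℝ) → ℝ) (hf : Measurable f) (hf0 : 0 < f 0)
    (hint : Integrable (fun z => f z ^ 2))
    (I : ℝ) (hI : (∫ z, f z ^ 2) = I) (hIpos : 0 < I)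
    (σ : ℝ) (hσ : 0 < σ)
    (lam : ℕ → ℝ) (hnn : ∀ n, 0 ≤ lam n) (hsum : Summable lam)
    (htrace : (∑' n, lam n) = f 0 * (volume D).toReal)
    (htrace2 : (∑' n, lam n ^ 2) = ∫ x in D, ∫ y in D, f (σ⁻¹ • (x - y)) ^ 2)
    (ε : ℝ) (hε : ε ∈ Set.Ioo (0 : ℝ) 1)
    (N : ℕ) (htail : (∑' m : ℕ, lam (N + m)) ≤ ε ^ 2 * ∑' m, lam m) :
    (1 - ε ^ 2) ^ 2 * 2 ^ d * f 0 ^ 2 * (volume D).toReal ^ 2 ≤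
      (N : ℝ) * I * (volume (D + D)).toReal * σ ^ d := by
  have hpartial : (1 - ε ^ 2) * (f 0 * (volume D).toReal) ≤ ∑ n ∈ Finset.range N, lam n := by
    have hsplit := hsum.sum_add_tsum_nat_add N
    simp only [add_comm _ N] at hsplit
    rw [← htrace]
    linarith
  have hnonneg : 0 ≤ (1 - ε ^ 2) * (f 0 * (volume D).toReal) :=
    mul_nonneg (by nlinarith [hε.1, hε.2]) (by positivity)
  have hkernel : ∑' n, lam n ^ 2 ≤ σ ^ d * I * (volume D).toReal := by
    rw [htrace2, ← hI]
    exact setIntegral_setIntegral_stationary_le hD.measure_lt_top (fun z => sq_nonneg (f z))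
      hint hσ
  calc (1 - ε ^ 2) ^ 2 * 2 ^ d * f 0 ^ 2 * (volume D).toReal ^ 2
      = ((1 - ε ^ 2) * (f 0 * (volume D).toReal)) ^ 2 * 2 ^ d := by ring
    _ ≤ (∑ n ∈ Finset.range N, lam n) ^ 2 * 2 ^ d := by gcongr
    _ ≤ (N * ∑' n, lam n ^ 2) * 2 ^ d := by
        gcongr
        exact sq_sum_range_le_mul_tsum_sq hnn hsum N
    _ ≤ (N * (σ ^ d * I * (volume D).toReal)) * 2 ^ d := by gcongr
    _ = N * I * (2 ^ d * (volume D).toReal) * σ ^ d := by ring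
    _ ≤ N * I * (volume (D + D)).toReal * σ ^ d := by
        gcongr
        exact two_pow_mul_volume_le_volume_add_self hD
end

section
/- Let τ > 0 and n ≥ 2, and let C be the n×n real matrix with entries C_{ij} = exp(−τ·|i−j|), 1 ≤ i,j ≤ n. Suppose θ ∈ (0,π) and ψ ∈ (−π/2, 0) satisfy tan ψ = (cos θ − e^τ)/sin θ and 2ψ + (n+1)θ = (k−1)π for some integer k. Then the vector u ∈ ℝ^n with entries u_j = cos(jθ + ψ), j = 1, …, n, is nonzero and satisfies C u = λ u with eigenvalue λ = sinh τ / (cosh τ − cos θ). -/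
section ExponentialKernel

variable {r c : ℝ} {w : ℕ → ℝ}

/-- Closed form of the part of the kernel sum below the diagonal, for a solution `w` of the
recurrence `w (j + 2) = 2 c w (j + 1) - w j` with left boundary condition `w 0 = r w 1`. -/
lemma mul_sum_range_pow_sub_mul (hrec : ∀ j, w (j + 2) = 2 * c * w (j + 1) - w j)
    (h0 : w 0 = r * w 1) (i m q : ℕ) (hm : m + q = i + 1) :
    (1 - 2 * r * c + r ^ 2) * ∑ j ∈ Finset.range m, r ^ ((i : ℤ) - j).natAbs * w (j + 1) =
      r ^ q * (w m - r * w (m + 1)) := by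
  induction m generalizing q with
  | zero => simp [h0]
  | succ m ih =>
    have hq : ((i : ℤ) - m).natAbs = q := by omega
    rw [Finset.sum_range_succ, mul_add, ih (q + 1) (by omega), hq, hrec m]
    ring

/-- Closed form of the kernel sum past the diagonal. -/
lemma mul_sum_range_pow_natAbs_mul (hrec : ∀ j, w (j + 2) = 2 * c * w (j + 1) - w j)
    (h0 : w 0 = r * w 1) (i p : ℕ) :
    (1 - 2 * r * c + r ^ 2) *
        ∑ j ∈ Finset.range (i + 1 + p), r ^ ((i : ℤ) - j).natAbs * w (j + 1) =
      (1 - r ^ 2) * w (i + 1) - r ^ (p + 1) * (w (i + 1 + p + 1) - r * w (i + 1 + p)) := by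
  induction p with
  | zero =>
    rw [add_zero, mul_sum_range_pow_sub_mul hrec h0 i (i + 1) 0 rfl]
    ring
  | succ p ih =>
    have hp : ((i : ℤ) - (i + 1 + p : ℕ)).natAbs = p + 1 := by omega
    rw [← add_assoc, Finset.sum_range_succ, mul_add, ih, hp, hrec (i + 1 + p)]
    ring

end ExponentialKernel

lemma cos_add_two_mul_add (θ ψ : ℝ) (j : ℕ) :
    Real.cos (((j + 2 : ℕ) : ℝ) * θ + ψ) =
      2 * Real.cos θ * Real.cos (((j + 1 : ℕ) : ℝ) * θ + ψ) - Real.cos ((j : ℝ) * θ + ψ) := by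
  have h₂ : ((j + 2 : ℕ) : ℝ) * θ + ψ = (((j + 1 : ℕ) : ℝ) * θ + ψ) + θ := by
    push_cast; ring
  have h₀ : (j : ℝ) * θ + ψ = (((j + 1 : ℕ) : ℝ) * θ + ψ) - θ := by
    push_cast; ring
  rw [h₂, h₀, Real.cos_add, Real.cos_sub]
  ring

/-- For the exponential covariance matrix `C_{ij} = exp(−τ|i−j|)` (indices `1..n`), if
`θ ∈ (0,π)`, `ψ ∈ (−π/2,0)` satisfy `tan ψ = (cos θ − e^τ)/sin θ` and
`2ψ + (n+1)θ = (k−1)π` for some integer `k`, then `u_j = cos(jθ + ψ)` (for `j = 1, …, n`)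
is a nonzero eigenvector of `C` with eigenvalue `sinh τ / (cosh τ − cos θ)`. -/
theorem stmt10 (τ : ℝ) (hτ : 0 < τ) (n : ℕ) (hn : 2 ≤ n)
    (C : Matrix (Fin n) (Fin n) ℝ)
    (hC : ∀ i j : Fin n, C i j = Real.exp (-τ * |(i.val : ℝ) - (j.val : ℝ)|))
    (θ ψ : ℝ) (hθ : θ ∈ Set.Ioo 0 Real.pi)
    (hψ : ψ ∈ Set.Ioo (-(Real.pi / 2)) 0)
    (htan : Real.tan ψ = (Real.cos θ - Real.exp τ) / Real.sin θ)
    (k : ℤ) (hquant : 2 * ψ + ((n : ℝ) + 1) * θ = ((k : ℝ) - 1) * Real.pi)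
    (u : Fin n → ℝ) (hu : ∀ j : Fin n, u j = Real.cos (((j.val : ℝ) + 1) * θ + ψ)) :
    u ≠ 0 ∧ C.mulVec u = (Real.sinh τ / (Real.cosh τ - Real.cos θ)) • u := by
  have hsin : 0 < Real.sin θ := Real.sin_pos_of_mem_Ioo hθ
  have hcosψ : 0 < Real.cos ψ :=
    Real.cos_pos_of_mem_Ioo ⟨hψ.1, hψ.2.trans (by positivity)⟩
  have hrτ : Real.exp (-τ) * Real.exp τ = 1 := by rw [← Real.exp_add]; simp
  have hleft : Real.cos (θ + ψ) = Real.exp τ * Real.cos ψ := by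
    rw [Real.tan_eq_sin_div_cos, div_eq_div_iff hcosψ.ne' hsin.ne'] at htan
    rw [Real.cos_add]
    linarith
  set r := Real.exp (-τ) with hr
  have h0' : Real.cos ψ = r * Real.cos (θ + ψ) := by
    rw [hleft, ← mul_assoc, hrτ, one_mul]
  let w : ℕ → ℝ := fun j => Real.cos ((j : ℝ) * θ + ψ)
  have hrec : ∀ j, w (j + 2) = 2 * Real.cos θ * w (j + 1) - w j := cos_add_two_mul_add θ ψ
  have h0 : w 0 = r * w 1 := by simpa [w] using h0'
  have hright : w (n + 1) = r * w n := by
    have h₁ : ((n + 1 : ℕ) : ℝ) * θ + ψ = ((k - 1 : ℤ) : ℝ) * Real.pi - ψ := by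
      push_cast; linarith
    have h₂ : (n : ℝ) * θ + ψ = ((k - 1 : ℤ) : ℝ) * Real.pi - (θ + ψ) := by
      push_cast; linarith
    simp only [w]
    rw [h₁, h₂, Real.cos_int_mul_pi_sub, Real.cos_int_mul_pi_sub, h0']
    ring
  have huw : ∀ j : Fin n, u j = w (j + 1) := fun j => by simp [hu, w]
  have hCr : ∀ i j : Fin n, C i j = r ^ ((i : ℤ) - (j : ℤ)).natAbs := fun i j => by
    rw [hC, hr, ← Real.exp_nat_mul, Nat.cast_natAbs]
    push_cast
    rw [mul_comm]
  refine ⟨fun hzero => ?_, ?_⟩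
  · have h := congrFun hzero ⟨0, by omega⟩
    rw [hu] at h
    simp [hleft, hcosψ.ne'] at h
  · ext i
    have hD : 0 < Real.cosh τ - Real.cos θ :=
      sub_pos.2 ((Real.cos_le_one θ).trans_lt (Real.one_lt_cosh.2 hτ.ne'))
    have hcosh : 2 * r * Real.cosh τ = 1 + r ^ 2 := by
      rw [Real.cosh_eq, ← hr]
      linear_combination hrτ
    have hsinh : 2 * r * Real.sinh τ = 1 - r ^ 2 := by
      rw [Real.sinh_eq, ← hr]
      linear_combination hrτ
    have hsum : (C.mulVec u) i =
        ∑ j ∈ Finset.range n, r ^ ((i.val : ℤ) - j).natAbs * w (j + 1) := by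
      rw [Finset.sum_range]
      simp only [Matrix.mulVec, dotProduct, hCr, huw]
    obtain ⟨p, hp⟩ := Nat.exists_eq_add_of_le (Nat.succ_le_of_lt i.isLt)
    have hmain := mul_sum_range_pow_natAbs_mul hrec h0 i.val p
    rw [← Nat.succ_eq_add_one, ← hp, ← hsum, hright, sub_self, mul_zero, sub_zero,
      Nat.succ_eq_add_one, ← huw] at hmain
    rw [Pi.smul_apply, smul_eq_mul, div_mul_eq_mul_div, eq_div_iff hD.ne']
    have hr0 : 2 * r ≠ 0 := by positivity
    apply mul_left_cancel₀ hr0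
    linear_combination hmain + (C.mulVec u) i * hcosh - u i * hsinh
end

section
/- Let τ > 0 and n ≥ 3, and let C be the n×n real matrix with entries C_{ij} = exp(−τ·|i−j|). If e ∈ ℝ^n and λ ≠ 0 satisfy C e = λ e, then the entries of e obey the three-term recurrence e_{j+1} − 2(cosh τ − (sinh τ)/λ) e_j + e_{j−1} = 0 for all j with 1 < j < n. -/
/-- The second-difference operator with coefficient `2 cosh τ` sends the kernel
`d ↦ exp (-τ |d|)` on the integers to `-2 sinh τ` times the delta function at `0`. -/
theorem exp_neg_mul_abs_second_difference (τ : ℝ) (d : ℤ) :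
    Real.exp (-τ * |(d : ℝ) + 1|) + Real.exp (-τ * |(d : ℝ) - 1|)
      - 2 * Real.cosh τ * Real.exp (-τ * |(d : ℝ)|) = if d = 0 then -2 * Real.sinh τ else 0 := by
  rcases lt_trichotomy d 0 with hd | rfl | hd
  · have hd' : (d : ℝ) + 1 ≤ 0 := by exact_mod_cast hd
    rw [if_neg hd.ne, abs_of_nonpos hd', abs_of_nonpos (by linarith : (d : ℝ) - 1 ≤ 0),
      abs_of_nonpos (by linarith : (d : ℝ) ≤ 0), Real.cosh_eq,
      show -τ * -((d : ℝ) + 1) = -τ * -(d : ℝ) + τ by ring,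
      show -τ * -((d : ℝ) - 1) = -τ * -(d : ℝ) + -τ by ring, Real.exp_add, Real.exp_add]
    ring
  · norm_num [Real.cosh_eq, Real.sinh_eq]
    ring
  · have hd' : (1 : ℝ) ≤ d := by exact_mod_cast hd
    rw [if_neg hd.ne', abs_of_nonneg (by linarith : 0 ≤ (d : ℝ) + 1),
      abs_of_nonneg (by linarith : 0 ≤ (d : ℝ) - 1),
      abs_of_nonneg (by linarith : 0 ≤ (d : ℝ)), Real.cosh_eq,
      show -τ * ((d : ℝ) + 1) = -τ * (d : ℝ) + -τ by ring,
      show -τ * ((d : ℝ) - 1) = -τ * (d : ℝ) + τ by ring, Real.exp_add, Real.exp_add]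
    ring

/-- If `C_{ij} = exp(−τ|i−j|)` and `C e = λ e` with `λ ≠ 0`, then the entries of `e`
satisfy the three-term recurrence `e_{j+1} − 2(cosh τ − sinh τ/λ) e_j + e_{j−1} = 0`
for all interior indices. (Indices here are `0`-based: interior means `0 < j < n−1`.) -/
theorem stmt11 (τ : ℝ) (hτ : 0 < τ) (n : ℕ) (hn : 3 ≤ n)
    (C : Matrix (Fin n) (Fin n) ℝ)
    (hC : ∀ i j : Fin n, C i j = Real.exp (-τ * |(i.val : ℝ) - (j.val : ℝ)|))
    (e : Fin n → ℝ) (lam : ℝ) (hlam : lam ≠ 0)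
    (heig : C.mulVec e = lam • e) :
    ∀ (j : ℕ) (h1 : 0 < j) (h2 : j + 1 < n),
      e ⟨j + 1, h2⟩ - 2 * (Real.cosh τ - Real.sinh τ / lam) * e ⟨j, by omega⟩
        + e ⟨j - 1, by omega⟩ = 0 := by
  intro j h1 h2
  have row (i : Fin n) : ∑ k, C i k * e k = lam * e i := congrFun heig i
  have entries (k : Fin n) : C ⟨j + 1, h2⟩ k + C ⟨j - 1, by omega⟩ k
      - 2 * Real.cosh τ * C ⟨j, by omega⟩ k
      = if k = ⟨j, by omega⟩ then -2 * Real.sinh τ else 0 := by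
    have hk : (j : ℤ) - (k.val : ℤ) = 0 ↔ k = ⟨j, by omega⟩ := by
      rw [Fin.ext_iff]
      dsimp only
      omega
    have h := exp_neg_mul_abs_second_difference τ ((j : ℤ) - (k.val : ℤ))
    simp only [hk] at h
    rw [← h, hC, hC, hC]
    push_cast [Nat.cast_sub (show 1 ≤ j from h1)]
    ring_nf
  have key : lam * e ⟨j + 1, h2⟩ + lam * e ⟨j - 1, by omega⟩
      - 2 * Real.cosh τ * (lam * e ⟨j, by omega⟩) = -2 * Real.sinh τ * e ⟨j, by omega⟩ := by
    rw [← row, ← row, ← row, Finset.mul_sum, ← Finset.sum_add_distrib,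
      ← Finset.sum_sub_distrib]
    simp_rw [← mul_assoc, ← add_mul, ← sub_mul, entries]
    simp
  field_simp
  linear_combination key
end

section
/- Let τ > 0 and ε ∈ (0,1), and define t = (2/π) · arctan( tanh(τ/2) · tan((π/2)(1 − ε²)) ). Then t ∈ (0,1) and ∫_{tπ}^{π} sinh τ / (cosh τ − cos x) dx = ε² · ∫_0^{π} sinh τ / (cosh τ − cos x) dx = ε² π. -/
open intervalIntegral

/-- Half-angle form of the denominator of the Poisson kernel. -/
lemma cosh_sub_cos_eq_half_angle (τ x : ℝ) :
    Real.cosh τ - Real.cos x = 2 * (Real.sinh (τ / 2) ^ 2 + Real.sin (x / 2) ^ 2) := by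
  have h1 := Real.cosh_two_mul (τ / 2)
  have h2 := Real.cos_two_mul (x / 2)
  have h3 := Real.cosh_sq (τ / 2)
  have h4 := Real.sin_sq_add_cos_sq (x / 2)
  rw [mul_div_cancel₀ _ (two_ne_zero' ℝ)] at h1 h2
  linarith

lemma cosh_sub_cos_pos {τ : ℝ} (hτ : 0 < τ) (x : ℝ) : 0 < Real.cosh τ - Real.cos x := by
  have := Real.one_lt_cosh.2 hτ.ne'
  linarith [Real.cos_le_one x]

lemma continuous_sinh_div_cosh_sub_cos {τ : ℝ} (hτ : 0 < τ) :
    Continuous fun x => Real.sinh τ / (Real.cosh τ - Real.cos x) :=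
  continuous_const.div (by fun_prop) fun x => (cosh_sub_cos_pos hτ x).ne'

lemma hasDerivAt_sin_half (x : ℝ) :
    HasDerivAt (fun y => Real.sin (y / 2)) (Real.cos (x / 2) * (1 / 2)) x :=
  ((hasDerivAt_id' x).div_const 2).sin

lemma hasDerivAt_cos_half (x : ℝ) :
    HasDerivAt (fun y => Real.cos (y / 2)) (-Real.sin (x / 2) * (1 / 2)) x :=
  ((hasDerivAt_id' x).div_const 2).cos

/-- A primitive of the Poisson kernel away from the odd multiples of `π`. -/
lemma hasDerivAt_arctan_tan_half {τ x : ℝ} (hτ : 0 < τ) (hx : Real.cos (x / 2) ≠ 0) :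
    HasDerivAt (fun y => 2 * Real.arctan
        (Real.cosh (τ / 2) / Real.sinh (τ / 2) * (Real.sin (y / 2) / Real.cos (y / 2))))
      (Real.sinh τ / (Real.cosh τ - Real.cos x)) x := by
  have hS : 0 < Real.sinh (τ / 2) := Real.sinh_pos_iff.2 (by linarith)
  refine ((((hasDerivAt_sin_half x).div (hasDerivAt_cos_half x) hx).const_mul
    (Real.cosh (τ / 2) / Real.sinh (τ / 2))).arctan.const_mul 2).congr_deriv ?_
  have h1 := Real.sinh_two_mul (τ / 2)
  rw [mul_div_cancel₀ _ (two_ne_zero' ℝ)] at h1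
  rw [cosh_sub_cos_eq_half_angle, h1]
  have h3 := Real.cosh_sq (τ / 2)
  have h4 := Real.sin_sq_add_cos_sq (x / 2)
  simp only [Pi.div_apply]
  generalize Real.sinh (τ / 2) = S at *
  generalize Real.cosh (τ / 2) = C at *
  generalize Real.sin (x / 2) = s at *
  generalize Real.cos (x / 2) = c at *
  have e1 : 1 + (C / S * (s / c)) ^ 2 = (S ^ 2 + s ^ 2) / (S ^ 2 * c ^ 2) := by
    field_simp
    linear_combination s ^ 2 * h3 + S ^ 2 * h4
  have e2 : c * (1 / 2) * c - s * (-s * (1 / 2)) = 1 / 2 := by linear_combination h4 / 2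
  have hp : S ^ 2 + s ^ 2 ≠ 0 := by positivity
  rw [e1, e2]
  field_simp

/-- A primitive of the Poisson kernel away from the even multiples of `π`. -/
lemma hasDerivAt_neg_arctan_cot_half {τ x : ℝ} (hτ : 0 < τ) (hx : Real.sin (x / 2) ≠ 0) :
    HasDerivAt (fun y => (-2) * Real.arctan
        (Real.sinh (τ / 2) / Real.cosh (τ / 2) * (Real.cos (y / 2) / Real.sin (y / 2))))
      (Real.sinh τ / (Real.cosh τ - Real.cos x)) x := by
  have hS : 0 < Real.sinh (τ / 2) := Real.sinh_pos_iff.2 (by linarith)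
  have hC := Real.cosh_pos (τ / 2)
  refine ((((hasDerivAt_cos_half x).div (hasDerivAt_sin_half x) hx).const_mul
    (Real.sinh (τ / 2) / Real.cosh (τ / 2))).arctan.const_mul (-2)).congr_deriv ?_
  have h1 := Real.sinh_two_mul (τ / 2)
  rw [mul_div_cancel₀ _ (two_ne_zero' ℝ)] at h1
  rw [cosh_sub_cos_eq_half_angle, h1]
  have h3 := Real.cosh_sq (τ / 2)
  have h4 := Real.sin_sq_add_cos_sq (x / 2)
  simp only [Pi.div_apply]
  generalize Real.sinh (τ / 2) = S at *
  generalize Real.cosh (τ / 2) = C at *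
  generalize Real.sin (x / 2) = s at *
  generalize Real.cos (x / 2) = c at *
  have e1 : 1 + (S / C * (c / s)) ^ 2 = (S ^ 2 + s ^ 2) / (C ^ 2 * s ^ 2) := by
    field_simp
    linear_combination s ^ 2 * h3 + S ^ 2 * h4
  have e2 : -s * (1 / 2) * s - c * (c * (1 / 2)) = -(1 / 2) := by linear_combination -h4 / 2
  have hp : S ^ 2 + s ^ 2 ≠ 0 := by positivity
  rw [e1, e2]
  field_simp

/-- For `τ > 0`, `ε ∈ (0,1)` and `t = (2/π) arctan(tanh(τ/2) tan((π/2)(1−ε²)))`, we have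
`t ∈ (0,1)` and `∫_{tπ}^π sinh τ/(cosh τ − cos x) dx = ε² ∫_0^π sinh τ/(cosh τ − cos x) dx
= ε² π`. -/
theorem stmt14 (τ ε : ℝ) (hτ : 0 < τ) (hε : ε ∈ Set.Ioo (0 : ℝ) 1)
    (t : ℝ)
    (ht : t = (2 / Real.pi) *
      Real.arctan (Real.tanh (τ / 2) * Real.tan ((Real.pi / 2) * (1 - ε ^ 2)))) :
    t ∈ Set.Ioo (0 : ℝ) 1 ∧
    (∫ x in (t * Real.pi)..Real.pi, Real.sinh τ / (Real.cosh τ - Real.cos x)) =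
      ε ^ 2 * ∫ x in (0 : ℝ)..Real.pi, Real.sinh τ / (Real.cosh τ - Real.cos x) ∧
    (∫ x in (t * Real.pi)..Real.pi, Real.sinh τ / (Real.cosh τ - Real.cos x)) =
      ε ^ 2 * Real.pi := by
  obtain ⟨hε0, hε1⟩ := hε
  have hπ := Real.pi_pos
  have hS : 0 < Real.sinh (τ / 2) := Real.sinh_pos_iff.2 (by linarith)
  have hC := Real.cosh_pos (τ / 2)
  have hεsq : 0 < ε ^ 2 := by positivity
  have hεsq1 : ε ^ 2 < 1 := by nlinarith
  set θ := Real.pi / 2 * (1 - ε ^ 2) with hθ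
  have hθ0 : 0 < θ := by apply mul_pos <;> linarith
  have hθ1 : θ < Real.pi / 2 := by nlinarith
  have htan : 0 < Real.tan θ := Real.tan_pos_of_pos_of_lt_pi_div_two hθ0 hθ1
  rw [Real.tanh_eq_sinh_div_cosh] at ht
  set A := Real.arctan (Real.sinh (τ / 2) / Real.cosh (τ / 2) * Real.tan θ) with hA
  have hA0 : 0 < A := Real.arctan_pos.2 (by positivity)
  have hA1 : A < Real.pi / 2 := Real.arctan_lt_pi_div_two _
  have htπ : t * Real.pi = 2 * A := by rw [ht]; field_simp
  have htanA : Real.sin A / Real.cos A =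
      Real.sinh (τ / 2) / Real.cosh (τ / 2) * Real.tan θ := by
    rw [← Real.tan_eq_sin_div_cos, hA, Real.tan_arctan]
  have hcont := continuous_sinh_div_cosh_sub_cos hτ
  have hright : (∫ x in (t * Real.pi)..Real.pi, Real.sinh τ / (Real.cosh τ - Real.cos x)) =
      ε ^ 2 * Real.pi := by
    rw [integral_eq_sub_of_hasDerivAt (fun x hx => hasDerivAt_neg_arctan_cot_half hτ ?_)
      (hcont.intervalIntegrable _ _)]
    · have h : Real.sinh (τ / 2) / Real.cosh (τ / 2) * (Real.cos A / Real.sin A) =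
          Real.tan (Real.pi / 2 - θ) := by
        rw [Real.tan_pi_div_two_sub, ← inv_div (Real.sin A), htanA]
        field_simp
      rw [htπ, mul_div_cancel_left₀ _ (two_ne_zero' ℝ), h,
        Real.arctan_tan (by linarith) (by linarith)]
      simp only [Real.cos_pi_div_two, zero_div, mul_zero, Real.arctan_zero, hθ]
      ring
    · rw [htπ, Set.uIcc_of_le (by linarith)] at hx
      exact (Real.sin_pos_of_pos_of_lt_pi (by linarith [hx.1]) (by linarith [hx.2])).ne'
  have hleft : (∫ x in (0 : ℝ)..(t * Real.pi), Real.sinh τ / (Real.cosh τ - Real.cos x)) =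
      (1 - ε ^ 2) * Real.pi := by
    rw [integral_eq_sub_of_hasDerivAt (fun x hx => hasDerivAt_arctan_tan_half hτ ?_)
      (hcont.intervalIntegrable _ _)]
    · have h : Real.cosh (τ / 2) / Real.sinh (τ / 2) * (Real.sin A / Real.cos A) =
          Real.tan θ := by
        rw [htanA]
        field_simp
      rw [htπ, mul_div_cancel_left₀ _ (two_ne_zero' ℝ), h,
        Real.arctan_tan (by linarith) (by linarith)]
      simp only [zero_div, Real.sin_zero, mul_zero, Real.arctan_zero, hθ]
      ring
    · rw [htπ, Set.uIcc_of_le (by linarith)] at hx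
      exact (Real.cos_pos_of_mem_Ioo ⟨by linarith [hx.1], by linarith [hx.2]⟩).ne'
  have hfull : (∫ x in (0 : ℝ)..Real.pi, Real.sinh τ / (Real.cosh τ - Real.cos x)) =
      Real.pi := by
    rw [← integral_add_adjacent_intervals (hcont.intervalIntegrable 0 (t * Real.pi))
      (hcont.intervalIntegrable _ _), hleft, hright]
    ring
  exact ⟨⟨by nlinarith, by nlinarith⟩, by rw [hfull, hright], hright⟩
end
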